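/- arXiv:2211.10584 — 5 statements merged into one kernel-verified Lean document; each statement's English description precedes it below -/
import Mathlib

section
/- For every n ≥ 0 and all f, g ∈ Δ that are homogeneous of degree n (with respect to the grading deg p_k = k), the inner product ⟨f, g⟩ lies in 2^{n−a(n)}·ℤ₍₂₎, where a(n) is the largest integer m with m(m+1)/2 ≤ n. -/
open MvPolynomial

noncomputable section

/-- `R = ℚ[p₁,p₃,p₅,…]`: the variable `X k` represents `p_{2k+1}`. -/
abbrev FockR : Type := MvPolynomial ℕ ℚ

/-- `Δ = ℤ₍₂₎[p₁, 2p₃, 4p₅, …]`: the smallest subring of `R` containing all constants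
with odd denominator (i.e. the image of `ℤ₍₂₎`) and the elements `2^k p_{2k+1}`. -/
def Delta : Subring FockR :=
  Subring.closure ({f | ∃ q : ℚ, Odd q.den ∧ f = C q} ∪
    {f | ∃ k : ℕ, f = (2 : FockR) ^ k * X k})

/-- `z_μ` (as a rational) for the partition with odd parts corresponding to the
exponent vector `d` (where `d k` is the multiplicity of the part `2k+1`). -/
def zExp (d : ℕ →₀ ℕ) : ℚ :=
  ∏ k ∈ d.support, ((2 * k + 1 : ℚ) ^ d k * (Nat.factorial (d k)))

/-- The bilinear form on `R` for which the monomials `p_μ` are orthogonal with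
`⟨p_μ, p_μ⟩ = z_μ`. -/
def innerP (f g : FockR) : ℚ :=
  ∑ d ∈ f.support, coeff d f * coeff d g * zExp d

/-- The exponent vector of `p_μ`: part `p = 2k+1` of `μ` contributes to the variable `X k`. -/
def toExp {n : ℕ} (μ : Nat.Partition n) : ℕ →₀ ℕ :=
  (μ.parts.map (fun p => Finsupp.single ((p - 1) / 2) 1)).sum

/-- `p_μ` as an element of `R`. -/
def pMu {n : ℕ} (μ : Nat.Partition n) : FockR := monomial (toExp μ) 1

/-- `z_μ` for a partition `μ`. -/
def zPart {n : ℕ} (μ : Nat.Partition n) : ℚ :=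
  (μ.parts.dedup.map
    (fun k => (k : ℚ) ^ μ.parts.count k * (Nat.factorial (μ.parts.count k)))).prod

/-- `q_n = Σ_{μ ⊢ n, odd parts} (2^{ℓ(μ)}/z_μ) p_μ`. -/
def qFun (n : ℕ) : FockR :=
  ∑ μ ∈ Nat.Partition.odds n, ((2 : ℚ) ^ (Multiset.card μ.parts) / zPart μ) • pMu μ

/-- The operator `p_μ^*` (composite of the `k·∂/∂p_k`), for a partition with exponent
vector `e`, given by its action on coefficients. -/
def pStar (e : ℕ →₀ ℕ) (f : FockR) : FockR :=
  ∑ d ∈ f.support,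
    (coeff d f * ∏ k ∈ e.support, ((2 * k + 1 : ℚ) ^ e k * ((d k).descFactorial (e k)))) •
      monomial (d - e) (1 : ℚ)

/-- `q_n^* = Σ_{μ ⊢ n, odd parts} (2^{ℓ(μ)}/z_μ) p_μ^*`. -/
def qStar (n : ℕ) (f : FockR) : FockR :=
  ∑ μ ∈ Nat.Partition.odds n, ((2 : ℚ) ^ (Multiset.card μ.parts) / zPart μ) • pStar (toExp μ) f

/-- `ε(n)`: 0 if `n` even, 1 if `n` odd. -/
def eps (n : ℕ) : ℕ := n % 2

/-- `a(n)`: the largest integer `m` with `m(m+1)/2 ≤ n`. -/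
def aFun (n : ℕ) : ℕ := Nat.findGreatest (fun m => m * (m + 1) ≤ 2 * n) n

/-! Helper lemmas -/

def Z2 : Subring ℚ where
  carrier := {q | Odd q.den}
  mul_mem' := fun {a b} ha hb => Odd.of_dvd_nat (Nat.odd_mul.mpr ⟨ha, hb⟩) (Rat.mul_den_dvd a b)
  one_mem' := by simp
  add_mem' := fun {a b} ha hb => Odd.of_dvd_nat (Nat.odd_mul.mpr ⟨ha, hb⟩) (Rat.add_den_dvd a b)
  zero_mem' := by simp
  neg_mem' := fun {a} ha => by simpa using ha

lemma mem_Z2 (q : ℚ) : q ∈ Z2 ↔ Odd q.den := Iff.rfl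

def wt : (ℕ →₀ ℕ) →+ ℕ := Finsupp.weight (fun k : ℕ => k)

lemma coeff_Delta (f : FockR) (hf : f ∈ Delta) :
    ∀ d, ∃ c ∈ Z2, coeff d f = 2 ^ (wt d) * c := by
  induction hf using Subring.closure_induction with
  | mem x hx =>
    intro d
    rcases hx with ⟨q, hq, rfl⟩ | ⟨k, rfl⟩
    · rw [coeff_C]
      split_ifs with h
      · subst h
        exact ⟨q, hq, by simp⟩
      · exact ⟨0, Z2.zero_mem, by simp⟩
    · have h2 : (2 : FockR) ^ k * X k = monomial (Finsupp.single k 1) ((2:ℚ) ^ k) := by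
        rw [← C_mul_X_eq_monomial, C_pow]; rfl
      rw [h2, coeff_monomial]
      split_ifs with h
      · subst h
        exact ⟨1, Z2.one_mem, by simp [wt, Finsupp.weight_single]⟩
      · exact ⟨0, Z2.zero_mem, by simp⟩
  | zero => exact fun d => ⟨0, Z2.zero_mem, by simp⟩
  | one =>
    intro d
    rw [coeff_one]
    split_ifs with h
    · subst h
      exact ⟨1, Z2.one_mem, by simp⟩
    · exact ⟨0, Z2.zero_mem, by simp⟩
  | add x y _ _ hx hy =>
    intro d
    obtain ⟨a, ha, ha'⟩ := hx d
    obtain ⟨b, hb, hb'⟩ := hy d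
    exact ⟨a + b, Z2.add_mem ha hb, by rw [coeff_add, ha', hb']; ring⟩
  | neg x _ hx =>
    intro d
    obtain ⟨a, ha, ha'⟩ := hx d
    exact ⟨-a, Z2.neg_mem ha, by rw [coeff_neg, ha']; ring⟩
  | mul x y _ _ hx hy =>
    intro d
    choose a ha ha' using hx
    choose b hb hb' using hy
    refine ⟨∑ p ∈ Finset.HasAntidiagonal.antidiagonal d, a p.1 * b p.2,
      Z2.sum_mem fun p _ => Z2.mul_mem (ha _) (hb _), ?_⟩
    rw [coeff_mul, Finset.mul_sum]
    refine Finset.sum_congr rfl fun p hp => ?_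
    rw [Finset.HasAntidiagonal.mem_antidiagonal] at hp
    rw [ha', hb', ← hp, map_add, pow_add]
    ring

lemma two_pow_mul_fact_dvd (e : ℕ) : 2 ^ e * e.factorial ∣ (2 * e).factorial := by
  induction e with
  | zero => simp
  | succ e ih =>
    obtain ⟨c, hc⟩ := ih
    refine ⟨c * (2 * e + 1), ?_⟩
    rw [show 2 * (e + 1) = 2 * e + 1 + 1 by ring, Nat.factorial_succ, Nat.factorial_succ, hc,
      Nat.factorial_succ]
    ring

lemma exists_bits (d : ℕ) : ∃ B : Finset ℕ, ∑ j ∈ B, 2 ^ j = d ∧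
    2 ^ d ∣ 2 ^ B.card * d.factorial := by
  induction d using Nat.strong_induction_on with
  | _ d ih =>
    rcases Nat.eq_zero_or_pos d with rfl | hd
    · exact ⟨∅, by simp⟩
    obtain ⟨e, he | he⟩ := Nat.even_or_odd' d
    · obtain ⟨B, hB, hdvd⟩ := ih e (by omega)
      refine ⟨B.map (addRightEmbedding 1), ?_, ?_⟩
      · simp [pow_succ, ← Finset.sum_mul, hB, he]; omega
      · rw [Finset.card_map, he, two_mul e, pow_add]
        calc 2 ^ e * 2 ^ e ∣ 2 ^ e * (2 ^ B.card * e.factorial) := mul_dvd_mul_left _ hdvd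
          _ = 2 ^ B.card * (2 ^ e * e.factorial) := by ring
          _ ∣ _ := mul_dvd_mul_left _ (by rw [← two_mul]; exact two_pow_mul_fact_dvd e)
    · obtain ⟨B, hB, hdvd⟩ := ih e (by omega)
      have h0 : 0 ∉ B.map (addRightEmbedding 1) := by simp
      refine ⟨insert 0 (B.map (addRightEmbedding 1)), ?_, ?_⟩
      · rw [Finset.sum_insert h0]
        simp [pow_succ, ← Finset.sum_mul, hB, he]; omega
      · rw [Finset.card_insert_of_notMem h0, Finset.card_map, he, Nat.factorial_succ]
        calc 2 ^ (2 * e + 1) = 2 * 2 ^ e * 2 ^ e := by ring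
          _ ∣ 2 * 2 ^ e * (2 ^ B.card * e.factorial) := mul_dvd_mul_left _ hdvd
          _ = 2 ^ (B.card + 1) * (2 ^ e * e.factorial) := by ring
          _ ∣ _ := mul_dvd_mul_left _ ((two_pow_mul_fact_dvd e).mul_left _)

lemma card_bound (s : Finset ℕ) : (∀ x ∈ s, 0 < x) → s.card * (s.card + 1) ≤ 2 * ∑ x ∈ s, x := by
  induction s using Finset.induction_on_max with
  | empty => simp
  | insert a s hmax ih =>
    intro h
    have hns : a ∉ s := fun h => lt_irrefl _ (hmax a h)
    have ih := ih fun x hx => h x (Finset.mem_insert_of_mem hx)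
    have ha := h a (Finset.mem_insert_self _ _)
    have hc : s.card ≤ a - 1 := by
      have : s ⊆ Finset.Ico 1 a := fun x hx =>
        Finset.mem_Ico.mpr ⟨h x (Finset.mem_insert_of_mem hx), hmax x hx⟩
      simpa using Finset.card_le_card this
    rw [Finset.card_insert_of_notMem hns, Finset.sum_insert hns]
    have : s.card + 1 ≤ a := by omega
    nlinarith

lemma odd_pow_inj {i j k l : ℕ} (h : 2 ^ j * (2 * k + 1) = 2 ^ i * (2 * l + 1)) :
    k = l ∧ j = i := by
  induction j generalizing i with
  | zero =>
    cases i with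
    | zero => simp at h; omega
    | succ i => rw [pow_succ, pow_zero, mul_assoc, mul_left_comm] at h; omega
  | succ j ih =>
    cases i with
    | zero => rw [pow_succ, pow_zero, mul_assoc, mul_left_comm] at h; omega
    | succ i =>
      have := @ih i (by rw [pow_succ, pow_succ] at h; linarith)
      omega

lemma key (n : ℕ) (d : ℕ →₀ ℕ) (hd : Finsupp.weight (fun k => 2 * k + 1) d = n) :
    ∃ N : ℕ, zExp d = N ∧ 2 ^ (n - aFun n) ∣ 2 ^ (2 * wt d) * N := by
  choose B hB hdvd using exists_bits
  set N := ∏ k ∈ d.support, ((2 * k + 1) ^ d k * (Nat.factorial (d k))) with hN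
  refine ⟨N, by simp [zExp, hN], ?_⟩
  set T := d.support.sigma (fun k => B (d k)) with hT
  have hn : n = 2 * wt d + ∑ k ∈ d.support, d k := by
    rw [← hd, wt, Finsupp.weight_apply, Finsupp.weight_apply, Finsupp.sum, Finsupp.sum,
      Finset.mul_sum, ← Finset.sum_add_distrib]
    refine Finset.sum_congr rfl fun k _ => ?_
    simp only [smul_eq_mul]; ring
  have h1 : 2 ^ (∑ k ∈ d.support, d k) ∣ 2 ^ T.card * N := by
    rw [hT, Finset.card_sigma, ← Finset.prod_pow_eq_pow_sum, ← Finset.prod_pow_eq_pow_sum, hN,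
      ← Finset.prod_mul_distrib]
    refine Finset.prod_dvd_prod_of_dvd _ _ fun k _ => ?_
    rw [mul_left_comm]
    exact (hdvd (d k)).mul_left _
  have hinj : Set.InjOn (fun p : (_ : ℕ) × ℕ => 2 ^ p.2 * (2 * p.1 + 1)) (T : Set _) := by
    rintro ⟨k, j⟩ _ ⟨l, i⟩ _ h
    obtain ⟨rfl, rfl⟩ := odd_pow_inj h
    rfl
  have hcard := Finset.card_image_of_injOn hinj
  have hb := card_bound (T.image (fun p : (_ : ℕ) × ℕ => 2 ^ p.2 * (2 * p.1 + 1))) (by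
    intro x hx
    obtain ⟨p, _, rfl⟩ := Finset.mem_image.mp hx
    positivity)
  rw [hcard, Finset.sum_image hinj, hT, Finset.sum_sigma, ← hT] at hb
  have hs : ∑ k ∈ d.support, ∑ j ∈ B (d k), 2 ^ j * (2 * k + 1) = n := by
    rw [← hd, Finsupp.weight_apply, Finsupp.sum]
    refine Finset.sum_congr rfl fun k _ => ?_
    rw [← Finset.sum_mul, hB, smul_eq_mul]
  simp only [hs] at hb
  have hTn : T.card ≤ n := by
    rcases Nat.eq_zero_or_pos T.card with h | h
    · omega
    · nlinarith
  have hTa : T.card ≤ aFun n := Nat.le_findGreatest hTn hb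
  have h2 : 2 ^ n ∣ 2 ^ T.card * (2 ^ (2 * wt d) * N) := by
    rw [hn, pow_add, mul_left_comm]
    exact mul_dvd_mul_left _ h1
  have h3 : 2 ^ (n - T.card) ∣ 2 ^ (2 * wt d) * N := by
    rw [← Nat.add_sub_cancel' hTn, pow_add] at h2
    exact Nat.dvd_of_mul_dvd_mul_left (by positivity) h2
  exact (pow_dvd_pow 2 (by omega)).trans h3

/-- For every `n ≥ 0` and all `f, g ∈ Δ` homogeneous of degree `n` (with `deg p_k = k`),
the inner product `⟨f, g⟩` lies in `2^{n - a(n)} ℤ₍₂₎`. -/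
theorem inner_product_on_Delta (n : ℕ) (f g : FockR) (hf : f ∈ Delta) (hg : g ∈ Delta)
    (hfh : f.IsWeightedHomogeneous (fun k => 2 * k + 1) n)
    (hgh : g.IsWeightedHomogeneous (fun k => 2 * k + 1) n) :
    ∃ c : ℚ, Odd c.den ∧ innerP f g = 2 ^ (n - aFun n) * c := by
  have : ∀ d ∈ f.support, ∃ c ∈ Z2, coeff d f * coeff d g * zExp d = 2 ^ (n - aFun n) * c := by
    intro d hd
    obtain ⟨a, ha, ha'⟩ := coeff_Delta f hf d
    obtain ⟨b, hb, hb'⟩ := coeff_Delta g hg d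
    obtain ⟨N, hN, M, hM⟩ := key n d (hfh (mem_support_iff.mp hd))
    refine ⟨a * b * (M : ℚ), Z2.mul_mem (Z2.mul_mem ha hb) (natCast_mem Z2 M), ?_⟩
    have hM' : (2 : ℚ) ^ (2 * wt d) * N = 2 ^ (n - aFun n) * M := by exact_mod_cast hM
    rw [ha', hb', hN]
    calc _ = a * b * ((2 : ℚ) ^ (2 * wt d) * N) := by ring
      _ = _ := by rw [hM']; ring
  choose! c hc hc' using this
  refine ⟨∑ d ∈ f.support, c d, (mem_Z2 _).mp (Z2.sum_mem hc), ?_⟩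
  rw [innerP, Finset.mul_sum]
  exact Finset.sum_congr rfl hc'

end
end

section
/- For every n ≥ 1 and every f ∈ Δ, the element 2^{(n+ε(n))/2}·(q_n·f) lies in 4Δ; equivalently, multiplication by q_n sends Δ into 2^{−(n+ε(n)−4)/2}·Δ. -/
open MvPolynomial

noncomputable section

theorem C_mem_aux (a : ℤ) (b : ℕ) (hb : Odd b) : (C ((a : ℚ) / b) : FockR) ∈ Delta := by
  apply Subring.subset_closure
  left
  refine ⟨_, ?_, rfl⟩
  have h := Rat.den_dvd a (b : ℤ)
  have h2 : (Rat.divInt a b).den ∣ b := by exact_mod_cast h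
  rw [Rat.divInt_eq_div] at h2
  have h3 : ((a : ℚ) / b).den ∣ b := by exact_mod_cast h2
  exact Odd.of_dvd_nat hb h3

theorem X_mem_aux (k : ℕ) : ((2 : FockR) ^ k * X k) ∈ Delta :=
  Subring.subset_closure (Or.inr ⟨k, rfl⟩)

theorem factor_aux (k m : ℕ) (hk : Odd k) (hm : m ≠ 0) :
    ∃ q : ℚ, (C q : FockR) ∈ Delta ∧
      (2 : ℚ) ^ m / ((k : ℚ) ^ m * (Nat.factorial m)) = 2 * q := by
  obtain ⟨a, b, hb, hab⟩ := Nat.exists_eq_two_pow_mul_odd (Nat.factorial_ne_zero m)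
  have h := Nat.emultiplicity_two_factorial_lt hm
  have ha : a < m := by
    by_contra hc
    push Not at hc
    have h1 : (2 : ℕ) ^ m ∣ Nat.factorial m := by
      rw [hab]
      exact Dvd.dvd.mul_right (pow_dvd_pow 2 hc) b
    exact absurd (le_emultiplicity_of_pow_dvd h1) (not_le.mpr h)
  obtain ⟨c, rfl⟩ := Nat.exists_eq_add_of_lt ha
  refine ⟨((2 ^ c : ℤ) : ℚ) / ((k ^ (a + c + 1) * b : ℕ) : ℚ), C_mem_aux _ _ (hk.pow.mul hb), ?_⟩
  rw [hab]
  have hk0 : (k : ℚ) ≠ 0 := by exact_mod_cast hk.pos.ne'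
  have hb0 : (b : ℚ) ≠ 0 := by exact_mod_cast hb.pos.ne'
  push_cast
  field_simp
  ring

theorem prod_aux (c : ℕ → ℕ) (s : Multiset ℕ) (h : ∀ k ∈ s, Odd k ∧ c k ≠ 0) :
    ∃ q : ℚ, (C q : FockR) ∈ Delta ∧
      (2 : ℚ) ^ (s.map c).sum /
        (s.map (fun k : ℕ => (k : ℚ) ^ c k * (Nat.factorial (c k)))).prod
        = 2 ^ (Multiset.card s) * q := by
  induction s using Multiset.induction_on with
  | empty => exact ⟨1, by simp, by simp⟩
  | cons k s ih =>
    obtain ⟨q, hq, he⟩ := ih (fun j hj => h j (Multiset.mem_cons_of_mem hj))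
    obtain ⟨hk, hm⟩ := h k (Multiset.mem_cons_self k s)
    obtain ⟨r, hr, hf⟩ := factor_aux k (c k) hk hm
    refine ⟨r * q, by rw [C_mul]; exact Delta.mul_mem hr hq, ?_⟩
    simp only [Multiset.map_cons, Multiset.sum_cons, Multiset.prod_cons, Multiset.card_cons]
    rw [pow_add, mul_div_mul_comm, hf, he]
    ring

theorem mono_aux (s : Multiset ℕ) (h : ∀ p ∈ s, Odd p) :
    ∃ S : ℕ, 2 * S + Multiset.card s = s.sum ∧ (2 : FockR) ^ S *
      monomial ((s.map (fun p => Finsupp.single ((p - 1) / 2) 1)).sum) (1 : ℚ) ∈ Delta := by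
  induction s using Multiset.induction_on with
  | empty => exact ⟨0, by simp, by simp⟩
  | cons k s ih =>
    obtain ⟨S, hS, hm⟩ := ih (fun j hj => h j (Multiset.mem_cons_of_mem hj))
    obtain ⟨j, rfl⟩ := h k (Multiset.mem_cons_self k s)
    refine ⟨j + S, by simp only [Multiset.card_cons, Multiset.sum_cons]; omega, ?_⟩
    have e : (2 * j + 1 - 1) / 2 = j := by omega
    have := Delta.mul_mem (X_mem_aux j) hm
    simp only [Multiset.map_cons, Multiset.sum_cons, e]
    convert this using 1
    rw [X, pow_add, mul_mul_mul_comm, monomial_mul, one_mul]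

theorem bind_aux (s : Multiset ℕ) :
    (s >>= fun a => (pure (a : ℚ) : Multiset ℚ)) = s.map (fun a : ℕ => (a : ℚ)) := by
  simp only [Multiset.bind_def, Multiset.pure_def]
  exact Multiset.bind_singleton s _

theorem zPart_aux {n : ℕ} (μ : Nat.Partition n) : zPart μ =
    (μ.parts.dedup.map (fun k : ℕ =>
      (k : ℚ) ^ μ.parts.count k * (Nat.factorial (μ.parts.count k)))).prod := by
  unfold zPart
  rw [bind_aux, bind_aux, Multiset.map_map]
  congr 1
  apply Multiset.map_congr rfl
  intro k _
  simp only [Function.comp]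
  rw [Multiset.count_map_eq_count' _ _ Nat.cast_injective]

theorem term_aux (n : ℕ) (hn : 1 ≤ n) (μ : Nat.Partition n) (h : μ ∈ Nat.Partition.odds n) :
    ∃ g ∈ Delta, (2 : FockR) ^ ((n + eps n) / 2) *
      (((2 : ℚ) ^ (Multiset.card μ.parts) / zPart μ) • pMu μ) = 4 * g := by
  have hodd : ∀ p ∈ μ.parts, Odd p := by
    intro p hp
    have := (Finset.mem_filter.mp h).2 p hp
    exact Nat.not_even_iff_odd.mp this
  obtain ⟨S, hS, hm⟩ := mono_aux μ.parts hodd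
  obtain ⟨q, hq, he⟩ := prod_aux (fun k => μ.parts.count k) μ.parts.dedup (fun k hk =>
    ⟨hodd k (Multiset.mem_dedup.mp hk),
      (Multiset.count_pos.mpr (Multiset.mem_dedup.mp hk)).ne'⟩)
  have hc : (μ.parts.dedup.map (fun k => μ.parts.count k)).sum = Multiset.card μ.parts :=
    Multiset.toFinset_sum_count_eq μ.parts
  rw [hc] at he
  have hz : (2 : ℚ) ^ (Multiset.card μ.parts) / zPart μ
      = 2 ^ (Multiset.card μ.parts.dedup) * q := by rw [zPart_aux]; exact he
  rw [μ.parts_sum] at hS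
  have h0 : μ.parts ≠ 0 := by
    intro h0
    have := μ.parts_sum
    rw [h0] at this
    simp at this
    omega
  have h1 : 0 < Multiset.card μ.parts := Multiset.card_pos.mpr h0
  have h2 : 0 < Multiset.card μ.parts.dedup := by
    obtain ⟨x, hx⟩ := Multiset.exists_mem_of_ne_zero h0
    exact Multiset.card_pos_iff_exists_mem.mpr ⟨x, Multiset.mem_dedup.mpr hx⟩
  rw [hz]
  generalize Multiset.card μ.parts.dedup = d at *
  generalize Multiset.card μ.parts = l at *
  obtain ⟨t, ht⟩ : ∃ t, (n + eps n) / 2 + d = S + t + 2 := by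
    refine ⟨(n + eps n) / 2 + d - S - 2, ?_⟩
    unfold eps
    omega
  have h2m : (2 : FockR) ∈ Delta := ofNat_mem Delta 2
  refine ⟨2 ^ t * (C q * (2 ^ S * pMu μ)),
    Delta.mul_mem (Delta.pow_mem h2m t) (Delta.mul_mem hq hm), ?_⟩
  rw [smul_eq_C_mul, C_mul, C_pow]
  have hC : (C (2 : ℚ) : FockR) = 2 := map_ofNat C 2
  rw [hC]
  calc (2 : FockR) ^ ((n + eps n) / 2) * (2 ^ d * C q * pMu μ)
      = 2 ^ ((n + eps n) / 2 + d) * (C q * pMu μ) := by ring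
    _ = _ := by rw [ht]; ring

/-- For every `n ≥ 1` and `f ∈ Δ`, the element `2^{(n+ε(n))/2}·(q_n·f)` lies in `4Δ`;
i.e. multiplication by `q_n` sends `Δ` into `2^{-(n+ε(n)-4)/2}·Δ`. -/
theorem qn_mul_maps_Delta (n : ℕ) (hn : 1 ≤ n) (f : FockR) (hf : f ∈ Delta) :
    ∃ g ∈ Delta, (2 : FockR) ^ ((n + eps n) / 2) * (qFun n * f) = 4 * g := by
  have key : ∃ g ∈ Delta, (2 : FockR) ^ ((n + eps n) / 2) * qFun n = 4 * g := by
    choose! g hg he using term_aux n hn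
    refine ⟨∑ μ ∈ Nat.Partition.odds n, g μ, Delta.sum_mem hg, ?_⟩
    rw [qFun, Finset.mul_sum, Finset.mul_sum]
    exact Finset.sum_congr rfl he
  obtain ⟨g, hg, he⟩ := key
  exact ⟨g * f, Delta.mul_mem hg hf, by rw [← mul_assoc, he, mul_assoc]⟩

end
end

section
/- For every n ≥ 1 and every f ∈ Δ, the element q_{n+1}·(q_n^*(f)) lies in 4Δ. -/
open MvPolynomial

noncomputable section

def ZTwo : Subring ℚ where
  carrier := {q | ∃ (a : ℤ) (b : ℕ), Odd b ∧ q * b = a}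
  mul_mem' := by
    rintro x y ⟨a, b, hb, h⟩ ⟨c, d, hd, h'⟩
    refine ⟨a * c, b * d, hb.mul hd, ?_⟩
    push_cast
    rw [← h, ← h']; ring
  one_mem' := ⟨1, 1, by simp⟩
  add_mem' := by
    rintro x y ⟨a, b, hb, h⟩ ⟨c, d, hd, h'⟩
    refine ⟨a * d + c * b, b * d, hb.mul hd, ?_⟩
    push_cast
    rw [← h, ← h']; ring
  zero_mem' := ⟨0, 1, by simp⟩
  neg_mem' := by
    rintro x ⟨a, b, hb, h⟩
    refine ⟨-a, b, hb, ?_⟩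
    push_cast
    rw [← h]; ring

theorem ZTwo_iff (q : ℚ) : q ∈ ZTwo ↔ Odd q.den := by
  constructor
  · rintro ⟨a, b, hb, h⟩
    have hb0 : (b : ℚ) ≠ 0 := by
      have := hb.pos
      positivity
    have hq : q = (a : ℚ) / ((b : ℤ) : ℚ) := by
      rw [eq_div_iff (by exact_mod_cast hb0)]; exact_mod_cast h
    have hd : (q.den : ℤ) ∣ (b : ℤ) := by
      rw [hq, ← Rat.divInt_eq_div]; exact Rat.den_dvd a b
    have hd' : q.den ∣ b := by exact_mod_cast hd
    exact Odd.of_dvd_nat hb hd'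
  · intro h
    exact ⟨q.num, q.den, h, Rat.mul_den_eq_num q⟩

theorem ZTwo_inv_odd {b : ℕ} (hb : Odd b) : (b : ℚ)⁻¹ ∈ ZTwo := by
  have hb0 : (b : ℚ) ≠ 0 := by
    have := hb.pos
    positivity
  exact ⟨1, b, hb, by field_simp; simp⟩

theorem ZTwo_two_pow_div_fact {m : ℕ} (hm : m ≠ 0) :
    (2 : ℚ) ^ m / (m.factorial : ℚ) / 2 ∈ ZTwo := by
  obtain ⟨v, b, hb, h⟩ := Nat.exists_eq_two_pow_mul_odd (Nat.factorial_ne_zero m)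
  have h1 := Nat.emultiplicity_two_factorial_lt hm
  have hv : v < m := by
    by_contra hc
    have : 2 ^ m ∣ m.factorial := by
      rw [h]; exact Dvd.dvd.mul_right (pow_dvd_pow 2 (not_lt.mp hc)) b
    exact absurd (le_emultiplicity_of_pow_dvd this) (not_le.mpr h1)
  obtain ⟨t, rfl⟩ := Nat.exists_eq_add_of_lt hv
  have hb0 : (b : ℚ) ≠ 0 := by
    have := hb.pos
    positivity
  have : (2 : ℚ) ^ (v + t + 1) / ((v + t + 1).factorial : ℚ) / 2 = ((2 ^ t : ℕ) : ℚ) * (b : ℚ)⁻¹ := by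
    rw [h]; push_cast; field_simp; ring
  rw [this]
  exact ZTwo.mul_mem (natCast_mem _ _) (ZTwo_inv_odd hb)

def wtE (d : ℕ →₀ ℕ) : ℕ := d.sum fun k m => k * m
def lenE (d : ℕ →₀ ℕ) : ℕ := d.sum fun _ m => m

theorem wtE_add (d e : ℕ →₀ ℕ) : wtE (d + e) = wtE d + wtE e := by
  unfold wtE
  exact Finsupp.sum_add_index' (by simp) (by intros; ring)

theorem lenE_add (d e : ℕ →₀ ℕ) : lenE (d + e) = lenE d + lenE e := by
  unfold lenE
  exact Finsupp.sum_add_index' (by simp) (by intros; ring)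

theorem monomial_mem_Delta (d : ℕ →₀ ℕ) (q : ℚ) (hq : q ∈ ZTwo) :
    (monomial d (2 ^ wtE d * q) : FockR) ∈ Delta := by
  have hX : ∀ k : ℕ, ((2 : FockR) ^ k * X k) ∈ Delta := fun k =>
    Subring.subset_closure (Or.inr ⟨k, rfl⟩)
  have hC : (C q : FockR) ∈ Delta :=
    Subring.subset_closure (Or.inl ⟨q, (ZTwo_iff q).1 hq, rfl⟩)
  have : (monomial d (2 ^ wtE d * q) : FockR)
      = C q * ∏ k ∈ d.support, ((2 : FockR) ^ k * X k) ^ d k := by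
    rw [monomial_eq]
    simp only [mul_pow, Finset.prod_mul_distrib, Finsupp.prod, wtE, Finsupp.sum, ← pow_mul,
      Finset.prod_pow_eq_pow_sum, map_mul, map_pow]
    have : (C 2 : FockR) = 2 := map_ofNat C 2
    rw [this]; ring
  rw [this]
  exact Delta.mul_mem hC (Subring.prod_mem _ fun k _ => Subring.pow_mem _ (hX k) _)

theorem mem_Delta_coeff {f : FockR} (hf : f ∈ Delta) :
    ∀ d, coeff d f / 2 ^ wtE d ∈ ZTwo := by
  unfold Delta at hf
  induction hf using Subring.closure_induction with
  | mem x hx =>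
    intro d
    rcases hx with ⟨q, hq, rfl⟩ | ⟨k, rfl⟩
    · rw [coeff_C]
      split_ifs with h
      · subst h; simpa [wtE] using (ZTwo_iff q).2 hq
      · simp
    · have : (2 : FockR) ^ k * X k = monomial (Finsupp.single k 1) ((2 : ℚ) ^ k) := by
        have h2 : (C 2 : FockR) = 2 := map_ofNat C 2
        rw [monomial_eq]; simp [h2]
      rw [this, coeff_monomial]
      split_ifs with h
      · subst h; simp [wtE, ZTwo.one_mem]
      · simp
  | zero => intro d; simp
  | one =>
    intro d
    rw [coeff_one]
    split_ifs with h
    · subst h; simpa [wtE] using ZTwo.one_mem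
    · simp
  | add x y _ _ hx hy =>
    intro d
    rw [coeff_add, add_div]; exact ZTwo.add_mem (hx d) (hy d)
  | neg x _ hx =>
    intro d
    rw [coeff_neg, neg_div]; exact ZTwo.neg_mem (hx d)
  | mul x y _ _ hx hy =>
    intro d
    rw [coeff_mul, Finset.sum_div]
    refine Subring.sum_mem _ fun p hp => ?_
    rw [Finset.HasAntidiagonal.mem_antidiagonal] at hp
    rw [← hp, wtE_add, pow_add, mul_div_mul_comm]
    exact ZTwo.mul_mem (hx _) (hy _)

def Eof (s : Multiset ℕ) : ℕ →₀ ℕ :=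
  (s.map (fun p => Finsupp.single ((p - 1) / 2) 1)).sum

theorem Eof_cons (a : ℕ) (s : Multiset ℕ) :
    Eof (a ::ₘ s) = Finsupp.single ((a - 1) / 2) 1 + Eof s := by simp [Eof]

theorem Eof_facts (s : Multiset ℕ) (hs : ∀ p ∈ s, Odd p) :
    lenE (Eof s) = s.card ∧ 2 * wtE (Eof s) + s.card = s.sum ∧
      ∀ k, Eof s k = s.count (2 * k + 1) := by
  induction s using Multiset.induction_on with
  | empty => simp [Eof, lenE, wtE]
  | cons a s ih =>
    obtain ⟨h1, h2, h3⟩ := ih fun p hp => hs p (Multiset.mem_cons_of_mem hp)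
    obtain ⟨j, rfl⟩ := hs a (Multiset.mem_cons_self a s)
    have hj : (2 * j + 1 - 1) / 2 = j := by omega
    have ew : wtE (Finsupp.single j 1) = j := by simp [wtE]
    have el : lenE (Finsupp.single j 1) = 1 := by simp [lenE]
    rw [Eof_cons, hj]
    refine ⟨?_, ?_, ?_⟩
    · rw [lenE_add, el, h1, Multiset.card_cons]; ring
    · rw [wtE_add, ew, Multiset.card_cons, Multiset.sum_cons]; omega
    · intro k
      rw [Finsupp.add_apply, h3, Multiset.count_cons, Finsupp.single_apply]
      have : (j = k) ↔ (2 * k + 1 = 2 * j + 1) := by omega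
      simp only [this]; ring

section part
variable {n : ℕ} {μ : Nat.Partition n}

theorem odds_mem (h : μ ∈ Nat.Partition.odds n) : ∀ p ∈ μ.parts, Odd p := by
  intro p hp
  simp only [Nat.Partition.odds, Nat.Partition.restricted, Finset.mem_filter] at h
  have := h.2 p hp
  simpa using this

theorem toExp_len (h : μ ∈ Nat.Partition.odds n) : lenE (toExp μ) = μ.parts.card :=
  (Eof_facts μ.parts (odds_mem h)).1

theorem toExp_wt (h : μ ∈ Nat.Partition.odds n) : 2 * wtE (toExp μ) + lenE (toExp μ) = n := by
  have := (Eof_facts μ.parts (odds_mem h)).2.1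
  rw [μ.parts_sum] at this
  rw [toExp_len h]; exact this

theorem toExp_apply (h : μ ∈ Nat.Partition.odds n) (k : ℕ) :
    toExp μ k = μ.parts.count (2 * k + 1) :=
  (Eof_facts μ.parts (odds_mem h)).2.2 k

theorem zPart_eq (h : μ ∈ Nat.Partition.odds n) : zPart μ = zExp (toExp μ) := by
  have : zPart μ = ∏ k ∈ μ.parts.toFinset,
    ((k : ℚ) ^ μ.parts.count k * (Nat.factorial (μ.parts.count k))) := by
    rw [zPart, Finset.prod_eq_multiset_prod, Multiset.toFinset_val]
    have hb : ∀ s : Multiset ℕ, (do let a ← s; pure (a : ℚ) : Multiset ℚ)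
        = s.map (fun a : ℕ => (a : ℚ)) := fun s => by
      simp only [Multiset.bind_def, Multiset.pure_def, Multiset.bind_singleton]
    rw [hb, hb, Multiset.map_map]
    refine congrArg Multiset.prod (Multiset.map_congr rfl fun k _ => ?_)
    simp only [Function.comp_apply]
    rw [Multiset.count_map_eq_count' _ _ Nat.cast_injective]
  rw [this, zExp]
  symm
  refine Finset.prod_nbij' (fun k => 2 * k + 1) (fun p => (p - 1) / 2) ?_ ?_ ?_ ?_ ?_
  · intro k hk
    rw [Finsupp.mem_support_iff, toExp_apply h] at hk
    rw [Multiset.mem_toFinset]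
    exact Multiset.count_ne_zero.mp hk
  · intro p hp
    rw [Multiset.mem_toFinset] at hp
    obtain ⟨j, rfl⟩ := odds_mem h p hp
    rw [Finsupp.mem_support_iff, toExp_apply h]
    have : (2 * j + 1 - 1) / 2 = j := by omega
    rw [this]
    exact Multiset.count_ne_zero.mpr hp
  · intro k _; omega
  · intro p hp
    rw [Multiset.mem_toFinset] at hp
    obtain ⟨j, rfl⟩ := odds_mem h p hp
    omega
  · intro k _
    rw [toExp_apply h]; push_cast; rfl

end part

theorem odd_prod_inv (e : ℕ →₀ ℕ) : (∏ k ∈ e.support, (2 * k + 1 : ℚ) ^ e k)⁻¹ ∈ ZTwo := by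
  have : (∏ k ∈ e.support, (2 * k + 1 : ℚ) ^ e k)⁻¹
      = ∏ k ∈ e.support, (((2 * k + 1 : ℕ) : ℚ)⁻¹) ^ e k := by
    rw [← Finset.prod_inv_distrib]
    refine Finset.prod_congr rfl fun k _ => ?_
    rw [inv_pow]; push_cast; rfl
  rw [this]
  exact Subring.prod_mem _ fun k _ => Subring.pow_mem _ (ZTwo_inv_odd (odd_two_mul_add_one k)) _

theorem coef_mem (e : ℕ →₀ ℕ) (he : 0 < lenE e) : (2 : ℚ) ^ lenE e / zExp e / 2 ∈ ZTwo := by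
  have hne : e.support.Nonempty := by
    by_contra hc
    rw [Finset.not_nonempty_iff_eq_empty] at hc
    simp [lenE, Finsupp.sum, hc] at he
  obtain ⟨k₀, hk₀⟩ := hne
  have h1 : (2 : ℚ) ^ lenE e / zExp e / 2 = (∏ k ∈ e.support, (2 * k + 1 : ℚ) ^ e k)⁻¹ *
      ((2 : ℚ) ^ e k₀ / ((e k₀).factorial : ℚ) / 2 *
        ∏ k ∈ e.support.erase k₀, (2 : ℚ) * ((2 : ℚ) ^ e k / ((e k).factorial : ℚ) / 2)) := by
    have h2 : ∏ k ∈ e.support.erase k₀, (2 : ℚ) * ((2 : ℚ) ^ e k / ((e k).factorial : ℚ) / 2)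
      = ∏ k ∈ e.support.erase k₀, ((2 : ℚ) ^ e k / ((e k).factorial : ℚ)) :=
      Finset.prod_congr rfl fun k _ => by ring
    have h3 := Finset.mul_prod_erase e.support
      (fun k => ((2 : ℚ) ^ e k / ((e k).factorial : ℚ))) hk₀
    rw [h2, div_mul_eq_mul_div, h3, zExp, lenE, Finsupp.sum, ← Finset.prod_pow_eq_pow_sum,
      Finset.prod_mul_distrib, Finset.prod_div_distrib]
    rw [div_eq_mul_inv, div_eq_mul_inv, mul_inv]; ring
  rw [h1]
  have h2 : (2 : ℚ) ∈ ZTwo := by exact_mod_cast natCast_mem ZTwo 2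
  exact ZTwo.mul_mem (odd_prod_inv e) (ZTwo.mul_mem
    (ZTwo_two_pow_div_fact (Finsupp.mem_support_iff.1 hk₀))
    (Subring.prod_mem _ fun k hk => ZTwo.mul_mem h2
      (ZTwo_two_pow_div_fact (Finsupp.mem_support_iff.1 (Finset.mem_of_mem_erase hk)))))

theorem len_pos {n : ℕ} (hn : 1 ≤ n) (e : ℕ →₀ ℕ) (h : 2 * wtE e + lenE e = n) : 0 < lenE e := by
  by_contra hc
  have h0 : lenE e = 0 := by omega
  have : e = 0 := by
    ext k
    by_contra hk
    have hs : k ∈ e.support := Finsupp.mem_support_iff.2 hk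
    rw [lenE, Finsupp.sum, Finset.sum_eq_zero_iff] at h0
    exact hk (h0 k hs)
  subst this
  simp [wtE, lenE] at h
  omega

/-- multiples of `c` in `Delta` -/
def cDelta (c : FockR) : AddSubgroup FockR where
  carrier := {f | ∃ g ∈ Delta, f = c * g}
  add_mem' := by
    rintro _ _ ⟨g, hg, rfl⟩ ⟨h, hh, rfl⟩
    exact ⟨g + h, Delta.add_mem hg hh, by ring⟩
  zero_mem' := ⟨0, Delta.zero_mem, by simp⟩
  neg_mem' := by
    rintro _ ⟨g, hg, rfl⟩
    exact ⟨-g, Delta.neg_mem hg, by ring⟩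

theorem mem_cDelta (c : ℚ) (d : ℕ →₀ ℕ) (r q : ℚ) (hq : q ∈ ZTwo) (h : r = c * (2 ^ wtE d * q)) :
    (monomial d r : FockR) ∈ cDelta (C c) :=
  ⟨_, monomial_mem_Delta d q hq, by rw [C_mul_monomial, h]⟩

theorem qFun_mem (n : ℕ) : (C (2 ^ (n / 2)) : FockR) * qFun (n + 1) ∈ cDelta (C 2) := by
  rw [qFun, Finset.mul_sum]
  refine AddSubgroup.sum_mem _ fun μ hμ => ?_
  have hw := toExp_wt hμ
  have hl := len_pos (by omega) _ hw
  rw [pMu, smul_monomial, C_mul_monomial, ← toExp_len hμ, zPart_eq hμ]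
  obtain ⟨t, ht⟩ : ∃ t, n / 2 = wtE (toExp μ) + t := Nat.exists_eq_add_of_le (by omega)
  have h2 : (2 : ℚ) ∈ ZTwo := by exact_mod_cast natCast_mem ZTwo 2
  refine mem_cDelta _ _ _ (2 ^ t * (2 ^ lenE (toExp μ) / zExp (toExp μ) / 2))
    (ZTwo.mul_mem (ZTwo.pow_mem h2 t) (coef_mem _ hl)) ?_
  rw [ht, smul_eq_mul]; ring

theorem qStar_mem (n : ℕ) (hn : 1 ≤ n) (f : FockR) (hf : f ∈ Delta) :
    qStar n f ∈ cDelta (C (2 ^ (n / 2 + 1))) := by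
  rw [qStar]
  refine AddSubgroup.sum_mem _ fun μ hμ => ?_
  have hw := toExp_wt hμ
  have hl := len_pos hn _ hw
  rw [← toExp_len hμ, zPart_eq hμ, pStar, Finset.smul_sum]
  generalize toExp μ = e at *
  refine AddSubgroup.sum_mem _ fun d _ => ?_
  rw [smul_smul, smul_monomial, smul_eq_mul, mul_one]
  have h2 : (2 : ℚ) ∈ ZTwo := by exact_mod_cast natCast_mem ZTwo 2
  by_cases hed : e ≤ d
  · have hd : d = (d - e) + e := (tsub_add_cancel_of_le hed).symm
    have hwd : wtE d = wtE (d - e) + wtE e := by rw [← wtE_add, ← hd]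
    obtain ⟨t, ht⟩ : ∃ t, wtE e + lenE e = n / 2 + 1 + t := Nat.exists_eq_add_of_le (by omega)
    have hz : (∏ k ∈ e.support, ((2 * k + 1 : ℚ) ^ e k * ((d k).descFactorial (e k))))
        = zExp e * ∏ k ∈ e.support, ((d k).choose (e k) : ℚ) := by
      rw [zExp, ← Finset.prod_mul_distrib]
      refine Finset.prod_congr rfl fun k _ => ?_
      rw [Nat.descFactorial_eq_factorial_mul_choose]; push_cast; ring
    have hz0 : zExp e ≠ 0 := by
      rw [zExp]
      refine Finset.prod_ne_zero_iff.2 fun k _ => ?_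
      positivity
    refine mem_cDelta _ _ _ (2 ^ t * ((∏ k ∈ e.support, ((d k).choose (e k) : ℚ)) *
      (coeff d f / 2 ^ wtE d))) (ZTwo.mul_mem (ZTwo.pow_mem h2 t) (ZTwo.mul_mem
        (Subring.prod_mem _ fun k _ => natCast_mem _ _) (mem_Delta_coeff hf d))) ?_
    rw [hz]
    have e1 : (2 : ℚ) ^ lenE e * 2 ^ wtE e = 2 ^ (n / 2 + 1) * 2 ^ t := by
      rw [← pow_add, ← pow_add, ← ht, add_comm]
    have e2 : (2 : ℚ) ^ wtE d = 2 ^ wtE (d - e) * 2 ^ wtE e := by rw [hwd, pow_add]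
    have p1 : (2 : ℚ) ^ wtE (d - e) ≠ 0 := by positivity
    have p2 : (2 : ℚ) ^ wtE e ≠ 0 := by positivity
    rw [e2]
    generalize (2 : ℚ) ^ wtE (d - e) = a at *
    generalize (2 : ℚ) ^ wtE e = b at *
    generalize (∏ k ∈ e.support, ((d k).choose (e k) : ℚ)) = P
    generalize (2 : ℚ) ^ lenE e = L at *
    have e3 : L = 2 ^ (n / 2 + 1) * 2 ^ t / b := by rw [eq_div_iff p2, e1]
    rw [e3]
    field_simp
  · have : ∃ k, d k < e k := by
      by_contra hc
      push Not at hc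
      exact hed hc
    obtain ⟨k, hk⟩ := this
    have hz : (∏ k ∈ e.support, ((2 * k + 1 : ℚ) ^ e k * ((d k).descFactorial (e k)))) = 0 := by
      refine Finset.prod_eq_zero (i := k) (Finsupp.mem_support_iff.2 (by omega)) ?_
      rw [Nat.descFactorial_eq_zero_iff_lt.2 hk]; simp
    rw [hz]
    simp

/-- For every `n ≥ 1` and `f ∈ Δ`, the element `q_{n+1}·(q_n^*(f))` lies in `4Δ`. -/
theorem qnsucc_mul_qstar_maps_Delta (n : ℕ) (hn : 1 ≤ n) (f : FockR) (hf : f ∈ Delta) :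
    ∃ g ∈ Delta, qFun (n + 1) * qStar n f = 4 * g := by
  obtain ⟨g₁, hg₁, h₁⟩ := qFun_mem n
  obtain ⟨g₂, hg₂, h₂⟩ := qStar_mem n hn f hf
  refine ⟨g₁ * g₂, Delta.mul_mem hg₁ hg₂, ?_⟩
  have h0 : (C (2 ^ (n / 2)) : FockR) ≠ 0 := by
    rw [Ne, C_eq_zero]; positivity
  apply mul_left_cancel₀ h0
  rw [← mul_assoc, h₁, h₂, pow_succ, map_mul]
  have : (C 2 : FockR) = 2 := map_ofNat C 2
  rw [this]; ring

end
end

section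
/- For every n ≥ 1 and every partition μ of n all of whose parts are odd, ℓ(μ) − v₂(z_μ) ≤ a(n), where a(n) is the largest integer m with m(m+1)/2 ≤ n. -/
/-- `z_μ = ∏_k k^{m_k(μ)}·m_k(μ)!` for a partition with parts given by the multiset
`parts` (where `m_k` is the multiplicity of the part `k`). -/
def zNat (parts : Multiset ℕ) : ℕ :=
  (parts.dedup.map (fun k => k ^ parts.count k * Nat.factorial (parts.count k))).prod

theorem aux_digits (m : ℕ) : (Nat.digits 2 m).sum = m.bitIndices.toFinset.card := by
  rw [List.toFinset_card_of_nodup (by exact Nat.bitIndices_sorted.nodup)]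
  induction m using Nat.binaryRec with
  | zero => simp
  | bit b n ih =>
    cases b
    · rcases Nat.eq_zero_or_pos n with rfl | h
      · simp
      · rw [Nat.bitIndices_bit_false, List.length_map, ← ih]
        rw [Nat.bit_false_apply]
        have := Nat.digits_add_two_add_one 0 (2 * n - 1)
        have e : 2 * n - 1 + 1 = 2 * n := by omega
        rw [e] at this
        simp at this
        simp [this]
    · rw [Nat.bitIndices_bit_true, List.length_cons, List.length_map, ← ih]
      rw [Nat.bit_true_apply]
      have := Nat.digits_add_two_add_one 0 (2 * n)
      have e : (2 * n + 1) / 2 = n := by omega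
      simp only [Nat.zero_add, e] at this
      rw [this]
      simp
      omega

theorem aux_fact (m : ℕ) :
    m = padicValNat 2 m.factorial + m.bitIndices.toFinset.card := by
  have h := sub_one_mul_padicValNat_factorial (p := 2) m
  have h2 := Nat.digit_sum_le 2 m
  rw [aux_digits] at h h2
  omega

theorem aux_sum (s : Finset ℕ) : 0 ∉ s → s.card * (s.card + 1) ≤ 2 * ∑ x ∈ s, x := by
  induction s using Finset.induction_on_max with
  | empty => simp
  | insert a s hlt ih =>
    intro h0
    simp only [Finset.mem_insert, not_or] at h0
    have ha : a ∉ s := fun h => lt_irrefl _ (hlt a h)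
    rw [Finset.card_insert_of_notMem ha, Finset.sum_insert ha]
    have hc : s.card ≤ (Finset.Ioo 0 a).card := Finset.card_le_card fun x hx => by
      have := hlt x hx
      have : x ≠ 0 := fun h => h0.2 (h ▸ hx)
      simp; omega
    simp at hc
    have := ih h0.2
    have : s.card + 1 ≤ a := by have := h0.1; omega
    nlinarith

theorem aux_prod (s : Finset ℕ) (f : ℕ → ℕ) : (∀ k ∈ s, f k ≠ 0) →
    padicValNat 2 (∏ k ∈ s, f k) = ∑ k ∈ s, padicValNat 2 (f k) := by
  induction s using Finset.induction_on with
  | empty => simp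
  | insert a s ha ih =>
    intro h
    rw [Finset.prod_insert ha, Finset.sum_insert ha, padicValNat.mul (h a (by simp))
      (Finset.prod_ne_zero_iff.2 fun k hk => h k (by simp [hk])),
      ih fun k hk => h k (by simp [hk])]

theorem aux_inj {i j k l : ℕ} (hk : Odd k) (hl : Odd l) (h : 2 ^ i * k = 2 ^ j * l) :
    i = j ∧ k = l := by
  have key : ∀ {i k : ℕ}, Odd k → padicValNat 2 (2 ^ i * k) = i := by
    intro i k hk
    have h1 : ¬ 2 ∣ k := by rw [← even_iff_two_dvd]; simpa using hk
    have : k ≠ 0 := by rintro rfl; simp at h1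
    rw [padicValNat.mul (by positivity) this, padicValNat.prime_pow,
      padicValNat.eq_zero_of_not_dvd h1, add_zero]
  have hij : i = j := by rw [← key (i := i) hk, h, key hl]
  subst hij
  exact ⟨rfl, Nat.eq_of_mul_eq_mul_left (by positivity) h⟩

/-- For every `n ≥ 1` and every partition `μ` of `n` with all parts odd,
`ℓ(μ) - v₂(z_μ) ≤ a(n)`. -/
theorem length_sub_valuation_le (n : ℕ) (hn : 1 ≤ n) (μ : Nat.Partition n)
    (hodd : ∀ p ∈ μ.parts, Odd p) :
    (Multiset.card μ.parts : ℤ) - padicValNat 2 (zNat μ.parts) ≤ aFun n := by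
  set P := μ.parts with hP
  set D := P.toFinset with hD
  have hodd' : ∀ k ∈ D, Odd k := fun k hk => hodd k (by simpa [hD] using hk)
  have hz : zNat P = ∏ k ∈ D, (k ^ P.count k * (P.count k).factorial) := rfl
  have hv : padicValNat 2 (zNat P) = ∑ k ∈ D, padicValNat 2 (P.count k).factorial := by
    rw [hz, aux_prod]
    · apply Finset.sum_congr rfl
      intro k hk
      have h1 : ¬ 2 ∣ k := by rw [← even_iff_two_dvd]; simpa using hodd' k hk
      have h0 : k ≠ 0 := by rintro rfl; simp at h1
      rw [padicValNat.mul (by positivity) (Nat.factorial_ne_zero _), padicValNat.pow,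
        padicValNat.eq_zero_of_not_dvd h1]
      simp
    · intro k hk
      have h0 : k ≠ 0 := (hodd' k hk).pos.ne'
      have := Nat.factorial_ne_zero (P.count k)
      positivity
  set L := ∑ k ∈ D, (P.count k).bitIndices.toFinset.card with hL
  have hcard : P.card = padicValNat 2 (zNat P) + L := by
    rw [hv, hL, ← Finset.sum_add_distrib, ← Multiset.toFinset_sum_count_eq]
    exact Finset.sum_congr rfl fun k _ => aux_fact _
  have hsum : n = ∑ k ∈ D, P.count k * k := by
    rw [← μ.parts_sum, ← hP, Finset.sum_multiset_count]
    simp [hD]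
  set T : Finset (Σ _ : ℕ, ℕ) := D.sigma fun k => (P.count k).bitIndices.toFinset with hT
  have hinj : Set.InjOn (fun x : (Σ _ : ℕ, ℕ) => 2 ^ x.2 * x.1) T := by
    rintro ⟨k, i⟩ hx ⟨l, j⟩ hy h
    simp only [hT, Finset.coe_sigma, Set.mem_sigma_iff, Finset.mem_coe] at hx hy
    obtain ⟨rfl, rfl⟩ := aux_inj (hodd' k hx.1) (hodd' l hy.1) h
    rfl
  have hS := aux_sum (T.image fun x => 2 ^ x.2 * x.1) (by
    intro h
    simp only [Finset.mem_image, hT, Finset.mem_sigma] at h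
    obtain ⟨x, hx, h⟩ := h
    have := (hodd' _ hx.1).pos
    have : 0 < 2 ^ x.2 * x.1 := by positivity
    omega)
  rw [Finset.card_image_of_injOn hinj, Finset.sum_image hinj, hT, Finset.card_sigma,
    Finset.sum_sigma, ← hL] at hS
  have hb : ∀ m : ℕ, ∑ i ∈ m.bitIndices.toFinset, 2 ^ i = m := by
    intro m
    rw [List.sum_toFinset _ (by exact Nat.bitIndices_sorted.nodup)]
    exact Nat.sum_map_two_pow_bitIndices m
  simp only [← Finset.sum_mul, hb, ← hsum] at hS
  have : L ≤ aFun n := by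
    refine Nat.le_findGreatest (P := fun m => m * (m + 1) ≤ 2 * n) ?_ hS
    nlinarith
  omega
end

section
/- For every nonempty partition μ all of whose parts are odd, v₂(z_μ) ≤ ℓ(μ) − 1. -/
/-- For every nonempty partition `μ` all of whose parts are odd (identified with the
multiset of its parts), `v₂(z_μ) ≤ ℓ(μ) - 1`. -/
theorem valuation_le_card_sub_one (μ : Multiset ℕ) (hne : μ ≠ 0)
    (hodd : ∀ p ∈ μ, Odd p) :
    padicValNat 2 (zNat μ) ≤ Multiset.card μ - 1 := by
  have hfact : Fact (Nat.Prime 2) := ⟨Nat.prime_two⟩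
  have hz : zNat μ = ∏ k ∈ μ.toFinset, (k ^ μ.count k * Nat.factorial (μ.count k)) := rfl
  have hterm : ∀ k ∈ μ.toFinset,
      padicValNat 2 (k ^ μ.count k * Nat.factorial (μ.count k)) < μ.count k := by
    intro k hk
    have hkμ : k ∈ μ := Multiset.mem_toFinset.mp hk
    have ho := hodd k hkμ
    have hk0 : k ≠ 0 := by rintro rfl; simp at ho
    rw [padicValNat.mul (pow_ne_zero _ hk0) (Nat.factorial_ne_zero _),
      padicValNat.pow, padicValNat.eq_zero_of_not_dvd ho.not_two_dvd_nat,
      mul_zero, zero_add]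
    exact padicValNat_factorial_lt_of_ne_zero 2 (Multiset.count_ne_zero.mpr hkμ)
  have hprod : ∀ s : Finset ℕ, s ⊆ μ.toFinset →
      padicValNat 2 (∏ k ∈ s, (k ^ μ.count k * Nat.factorial (μ.count k)))
        = ∑ k ∈ s, padicValNat 2 (k ^ μ.count k * Nat.factorial (μ.count k)) := by
    have hnz : ∀ k ∈ μ.toFinset, k ^ μ.count k * Nat.factorial (μ.count k) ≠ 0 := by
      intro k hk
      have ho := hodd k (Multiset.mem_toFinset.mp hk)
      have hk0 : k ≠ 0 := by rintro rfl; simp at ho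
      exact mul_ne_zero (pow_ne_zero _ hk0) (Nat.factorial_ne_zero _)
    intro s
    induction s using Finset.induction_on with
    | empty => intro _; simp
    | insert a s ha ih =>
      intro hs
      have hs' := Finset.insert_subset_iff.mp hs
      rw [Finset.prod_insert ha, Finset.sum_insert ha, padicValNat.mul (hnz a hs'.1)
        (Finset.prod_ne_zero_iff.mpr fun k hk => hnz k (hs'.2 hk)), ih hs'.2]
  have hlt : padicValNat 2 (zNat μ) < Multiset.card μ := by
    rw [hz, hprod _ (Finset.Subset.refl _), ← Multiset.toFinset_sum_count_eq μ]
    exact Finset.sum_lt_sum_of_nonempty (Multiset.toFinset_nonempty.mpr hne) hterm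
  omega
end
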